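/- Let x and y be positive integers with y odd and gcd(x, y) = 1. Then D(2x − y, 2xy; 2x + y) = −s(x, 2x + y). -/

import Mathlib

/-- The sawtooth function `((t))`: it is `t - ⌊t⌋ - 1/2` for `t ∉ ℤ` and `0` for `t ∈ ℤ`. -/
noncomputable def sawtooth (t : ℝ) : ℝ :=
  if Int.fract t = 0 then 0 else Int.fract t - 1 / 2

/-- The Dedekind sum `D(a, b; c) = ∑_{i=1}^{c-1} ((a i / c)) ((b i / c))`. -/
noncomputable def dedekindD (a b : ℤ) (c : ℕ) : ℝ :=
  ∑ i ∈ Finset.Ico 1 c, sawtooth ((a : ℝ) * i / c) * sawtooth ((b : ℝ) * i / c)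

/-- The classical two-argument Dedekind sum `s(b, c) = D(1, b; c)`. -/
noncomputable def dedekindS (b : ℤ) (c : ℕ) : ℝ := dedekindD 1 b c

theorem sawtooth_add_intCast (t : ℝ) (n : ℤ) : sawtooth (t + n) = sawtooth t := by
  simp [sawtooth]

theorem sawtooth_zero : sawtooth 0 = 0 := by
  simp [sawtooth]

theorem sawtooth_neg (t : ℝ) : sawtooth (-t) = -sawtooth t := by
  unfold sawtooth
  by_cases h : Int.fract t = 0
  · simp [h, Int.fract_neg_eq_zero]
  · rw [if_neg h, if_neg (mt Int.fract_neg_eq_zero.mp h), Int.fract_neg h]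
    ring

theorem sawtooth_div_congr {c : ℕ} (hc : c ≠ 0) {m n : ℤ} (h : (m : ZMod c) = n) :
    sawtooth (m / c) = sawtooth (n / c) := by
  obtain ⟨k, hk⟩ := (ZMod.intCast_eq_intCast_iff_dvd_sub n m c).mp h.symm
  have hc' : (c : ℝ) ≠ 0 := by exact_mod_cast hc
  have hm : (m : ℝ) / c = n / c + k := by
    have : (m : ℝ) - n = c * k := by exact_mod_cast hk
    field_simp
    linarith
  rw [hm, sawtooth_add_intCast]

/-- The sawtooth function at `z / c`, as a function of the residue `z` modulo `c`. -/
noncomputable def sawtoothMod (c : ℕ) (z : ZMod c) : ℝ := sawtooth ((z.cast : ℤ) / c)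

theorem sawtoothMod_intCast {c : ℕ} (hc : c ≠ 0) (m : ℤ) :
    sawtoothMod c m = sawtooth (m / c) :=
  sawtooth_div_congr hc (by simp)

theorem sawtoothMod_neg {c : ℕ} (hc : c ≠ 0) (z : ZMod c) :
    sawtoothMod c (-z) = -sawtoothMod c z := by
  obtain ⟨m, rfl⟩ := ZMod.intCast_surjective z
  rw [← Int.cast_neg, sawtoothMod_intCast hc, sawtoothMod_intCast hc, Int.cast_neg, neg_div,
    sawtooth_neg]

/-- A Dedekind sum is a sum over all residues modulo `c`. -/
theorem dedekindD_eq_sum_zmod (a b : ℤ) (c : ℕ) [NeZero c] :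
    dedekindD a b c = ∑ z : ZMod c, sawtoothMod c (a * z) * sawtoothMod c (b * z) := by
  have hc : c ≠ 0 := NeZero.ne c
  have hterm (d : ℤ) (i : ℕ) :
      sawtooth ((d : ℝ) * i / c) = sawtoothMod c (d * (i : ZMod c)) := by
    have := sawtoothMod_intCast hc (d * i)
    push_cast at this
    exact this.symm
  have hrange : dedekindD a b c = ∑ i ∈ Finset.range c,
      sawtoothMod c (a * (i : ZMod c)) * sawtoothMod c (b * (i : ZMod c)) := by
    rw [Finset.range_eq_Ico, Finset.sum_eq_sum_Ico_succ_bot (Nat.pos_of_ne_zero hc)]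
    simp [dedekindD, hterm, sawtoothMod, sawtooth_zero]
  rw [hrange]
  refine Finset.sum_nbij' (fun i : ℕ => (i : ZMod c)) ZMod.val ?_ ?_ ?_ ?_ ?_
  · simp
  · simp [ZMod.val_lt]
  · intro i hi
    exact ZMod.val_cast_of_lt (Finset.mem_range.mp hi)
  · simp
  · simp

theorem dedekindD_mul_left {c : ℕ} [NeZero c] {u : ℤ} (hu : IsUnit (u : ZMod c)) (a b : ℤ) :
    dedekindD (u * a) (u * b) c = dedekindD a b c := by
  rw [dedekindD_eq_sum_zmod, dedekindD_eq_sum_zmod]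
  obtain ⟨v, hv⟩ := hu
  refine Fintype.sum_equiv v.mulLeft _ _ fun z => ?_
  simp only [Units.mulLeft_apply, hv]
  push_cast
  congr 2 <;> ring

theorem dedekindD_neg_right (a b : ℤ) (c : ℕ) [NeZero c] :
    dedekindD a (-b) c = -dedekindD a b c := by
  simp [dedekindD_eq_sum_zmod, sawtoothMod_neg (NeZero.ne c)]

theorem dedekindD_congr {c : ℕ} [NeZero c] {a a' b b' : ℤ} (ha : (a : ZMod c) = a')
    (hb : (b : ZMod c) = b') : dedekindD a b c = dedekindD a' b' c := by
  simp [dedekindD_eq_sum_zmod, ha, hb]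

/-- For positive integers `x, y` with `y` odd and `gcd(x, y) = 1`,
`D(2x − y, 2xy; 2x + y) = −s(x, 2x + y)`. -/
theorem stmt_16 (x y : ℕ) (hx : 0 < x) (hy : 0 < y) (hodd : Odd y)
    (hgcd : Nat.gcd x y = 1) :
    dedekindD (2 * (x : ℤ) - y) (2 * (x : ℤ) * y) (2 * x + y)
      = -dedekindS (x : ℤ) (2 * x + y) := by
  have : NeZero (2 * x + y) := ⟨by omega⟩
  have hy' : (y : ZMod (2 * x + y)) = -(2 * x) := by
    have h := ZMod.natCast_self (2 * x + y)
    push_cast at h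
    linear_combination h
  have hx_cop : Nat.Coprime x (2 * x + y) := by
    rw [add_comm]
    simpa using hgcd
  have h2_cop : Nat.Coprime 2 (2 * x + y) := by
    rw [add_comm]
    simpa using hodd.coprime_two_left
  have hu : IsUnit (((4 * x : ℤ)) : ZMod (2 * x + y)) := by
    have h := (ZMod.isUnit_iff_coprime (4 * x) (2 * x + y)).mpr
      ((h2_cop.pow_left 2).mul_left hx_cop)
    exact_mod_cast h
  rw [dedekindS, ← dedekindD_mul_left hu 1 x, ← dedekindD_neg_right]
  apply dedekindD_congr <;> push_cast <;> rw [hy'] <;> ring
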